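/- Let p : ℝ → ℝ be a continuous, nonnegative, compactly supported function with ∫_ℝ p(y) dy = 1, and let σ > 0. Define the Gaussian kernel φ(u) = exp(−u²/(2σ²)) / (σ √(2π)), the smoothed density p_σ(x) = ∫_ℝ p(y) · φ(x − y) dy, and the posterior mean m(x) = ( ∫_ℝ y · p(y) · φ(x − y) dy ) / p_σ(x). Then: (i) p_σ(x) > 0 for every x ∈ ℝ; (ii) p_σ is differentiable on ℝ; and (iii) the score satisfies d/dx (log p_σ(x)) = ( m(x) − x ) / σ² for every x ∈ ℝ. -/

import Mathlib

/-!
Statement 9: the score-estimation identity of Section 2.2: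
for a Gaussian-smoothed density `p_σ`, the score satisfies
`d/dx log p_σ(x) = (m(x) - x) / σ²`, where `m` is the posterior-mean denoiser.
-/

open MeasureTheory Real

/-- Gaussian kernel `φ(u) = exp(-u²/(2σ²)) / (σ √(2π))`. -/
noncomputable def gaussKer (σ u : ℝ) : ℝ :=
  Real.exp (-u ^ 2 / (2 * σ ^ 2)) / (σ * Real.sqrt (2 * Real.pi))

/-- Smoothed density `p_σ(x) = ∫ p(y) φ(x - y) dy`. -/
noncomputable def smoothed (p : ℝ → ℝ) (σ x : ℝ) : ℝ :=
  ∫ y : ℝ, p y * gaussKer σ (x - y)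

/-- Posterior mean `m(x) = (∫ y p(y) φ(x - y) dy) / p_σ(x)`. -/
noncomputable def postMean (p : ℝ → ℝ) (σ x : ℝ) : ℝ :=
  (∫ y : ℝ, y * p y * gaussKer σ (x - y)) / smoothed p σ x

/-- The Gaussian kernel is positive. -/
lemma gaussKer_pos {σ : ℝ} (hσ : 0 < σ) (u : ℝ) : 0 < gaussKer σ u := by
  unfold gaussKer
  positivity

/-- The Gaussian kernel is bounded by its value at the origin. -/
lemma gaussKer_le {σ : ℝ} (hσ : 0 < σ) (u : ℝ) : gaussKer σ u ≤ 1 / (σ * √(2 * π)) := by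
  unfold gaussKer
  gcongr
  rw [Real.exp_le_one_iff, neg_div]
  exact neg_nonpos.mpr (by positivity)

lemma hasDerivAt_gaussKer (σ u : ℝ) : HasDerivAt (gaussKer σ) (-u / σ ^ 2 * gaussKer σ u) u := by
  have h := (((hasDerivAt_pow 2 u).neg.div_const (2 * σ ^ 2)).exp).div_const (σ * √(2 * π))
  refine h.congr_deriv ?_
  simp only [gaussKer, Pi.neg_apply]
  rcases eq_or_ne σ 0 with rfl | hσ
  · simp
  · field_simp
    simp [mul_comm]

lemma continuous_gaussKer (σ : ℝ) : Continuous (gaussKer σ) :=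
  continuous_iff_continuousAt.mpr fun u => (hasDerivAt_gaussKer σ u).continuousAt

/-- A continuous compactly supported function times a translated Gaussian is integrable. -/
lemma integrable_mul_gaussKer {q : ℝ → ℝ} (hc : Continuous q) (hq : HasCompactSupport q)
    (σ x : ℝ) : Integrable fun y => q y * gaussKer σ (x - y) :=
  (hc.mul ((continuous_gaussKer σ).comp (continuous_const.sub continuous_id)))
    |>.integrable_of_hasCompactSupport hq.mul_right

lemma smoothed_pos {p : ℝ → ℝ} (hc : Continuous p) (hnn : ∀ y, 0 ≤ p y)
    (hp : HasCompactSupport p) (hpos : 0 < ∫ y, p y) {σ : ℝ} (hσ : 0 < σ) (x : ℝ) :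
    0 < smoothed p σ x := by
  rw [integral_pos_iff_support_of_nonneg hnn (hc.integrable_of_hasCompactSupport hp)] at hpos
  refine (integral_pos_iff_support_of_nonneg
    (fun y => mul_nonneg (hnn y) (gaussKer_pos hσ _).le) (integrable_mul_gaussKer hc hp σ x)).2 ?_
  convert hpos using 2
  ext y
  simp [(gaussKer_pos hσ (x - y)).ne']

/-- Differentiation of the smoothed function under the integral sign. -/
lemma hasDerivAt_smoothed {p : ℝ → ℝ} (hc : Continuous p) (hp : HasCompactSupport p)
    {σ : ℝ} (hσ : 0 < σ) (x : ℝ) :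
    HasDerivAt (smoothed p σ)
      (((∫ y, y * p y * gaussKer σ (x - y)) - x * smoothed p σ x) / σ ^ 2) x := by
  have hg := continuous_gaussKer σ
  have hbound : Integrable fun y =>
      ‖p y‖ * ((|x| + 1 + |y|) / σ ^ 2 * (1 / (σ * √(2 * π)))) :=
    Continuous.integrable_of_hasCompactSupport (by fun_prop) hp.norm.mul_right
  have key := (hasDerivAt_integral_of_dominated_loc_of_deriv_le (μ := volume)
    (F := fun x y => p y * gaussKer σ (x - y))
    (F' := fun x y => p y * (-(x - y) / σ ^ 2 * gaussKer σ (x - y)))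
    (bound := fun y => ‖p y‖ * ((|x| + 1 + |y|) / σ ^ 2 * (1 / (σ * √(2 * π)))))
    (Metric.ball_mem_nhds x one_pos)
    (Filter.Eventually.of_forall fun z => (integrable_mul_gaussKer hc hp σ z).1)
    (integrable_mul_gaussKer hc hp σ x)
    (Continuous.aestronglyMeasurable (by fun_prop))
    (Filter.Eventually.of_forall fun y z hz => ?_)
    hbound
    (Filter.Eventually.of_forall fun y z _ =>
      ((hasDerivAt_gaussKer σ (z - y)).comp_sub_const z y).const_mul (p y))).2
  · refine key.congr_deriv ?_
    have h₁ := integrable_mul_gaussKer (q := fun y => y * p y) (by fun_prop) hp.mul_left σ x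
    have h₂ := (integrable_mul_gaussKer hc hp σ x).const_mul x
    rw [smoothed, ← integral_const_mul, ← integral_sub h₁ h₂, ← integral_div]
    congr with y
    ring
  · rw [norm_mul, norm_mul, norm_div, Real.norm_of_nonneg (gaussKer_pos hσ _).le, norm_neg,
      Real.norm_of_nonneg (sq_nonneg σ)]
    have hzx : |z - x| < 1 := by simpa [Real.dist_eq] using hz
    have hzy : ‖z - y‖ ≤ |x| + 1 + |y| := by
      have h₁ := abs_sub z y
      have h₂ := abs_sub_abs_le_abs_sub z x
      rw [Real.norm_eq_abs]
      linarith
    have := gaussKer_le hσ (z - y)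
    have := (gaussKer_pos hσ (z - y)).le
    gcongr

/-- **Score of the noise-smoothed marginal equals the rescaled residual of the
posterior-mean denoiser:** `p_σ` is everywhere positive, differentiable, and
`d/dx log p_σ(x) = (m(x) - x) / σ²`. -/
theorem score_eq_denoiser_residual (p : ℝ → ℝ)
    (hc : Continuous p) (hnn : ∀ y, 0 ≤ p y) (hsupp : HasCompactSupport p)
    (hint : ∫ y : ℝ, p y = 1) (σ : ℝ) (hσ : 0 < σ) :
    (∀ x, 0 < smoothed p σ x) ∧
    Differentiable ℝ (smoothed p σ) ∧
    ∀ x, deriv (fun x => Real.log (smoothed p σ x)) x = (postMean p σ x - x) / σ ^ 2 := by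
  have hpos := smoothed_pos hc hnn hsupp (hint ▸ one_pos) hσ
  have hderiv := hasDerivAt_smoothed hc hsupp hσ
  refine ⟨hpos, fun x => (hderiv x).differentiableAt, fun x => ?_⟩
  rw [((hderiv x).log (hpos x).ne').deriv, postMean]
  have := (hpos x).ne'
  field_simp
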